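/- arXiv:2307.15688 — 7 statements merged into one kernel-verified Lean document; each statement's English description precedes it below -/
import Mathlib

section
/- Let R be an associative unital ℚ-algebra and let i, j, k be three distinct indices. Suppose h_{ij}, h_{jk}, h_{ik} ∈ R satisfy the singlet-projector relations: h_{ij}² = h_{ij}, h_{jk}² = h_{jk}, h_{ik}² = h_{ik}, and for every ordering of the three indices the anticommutation relation h_{ab} h_{bc} + h_{bc} h_{ab} = (h_{ab} + h_{bc} − h_{ac})/2 holds (i.e., for (a,b,c) ∈ {(i,j,k), (j,i,k), (i,k,j)}). Then 4 · h_{ij} h_{jk} h_{ij} = h_{ij}. -/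
/-- Compressing the anticommutation relation of `p` and `q` by the idempotent `p`. -/
theorem compress_anticommutation {R : Type*} [Ring R] [Algebra ℚ R] {p q r : R}
    (hp : p * p = p) (h : p * q + q * p = (1 / 2 : ℚ) • (p + q - r)) :
    (3 : ℚ) • (p * q * p) + p * r * p = p := by
  have hl : p * (p * q + q * p) * p = (2 : ℚ) • (p * q * p) := by
    rw [mul_add, add_mul, ← mul_assoc p p q, hp, ← mul_assoc p q p, mul_assoc (p * q) p p, hp,
      two_smul]
  have hr : p * ((1 / 2 : ℚ) • (p + q - r)) * p
      = (1 / 2 : ℚ) • (p + p * q * p - p * r * p) := by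
    rw [mul_smul_comm, smul_mul_assoc, mul_sub, mul_add, sub_mul, add_mul, hp, hp]
  have key := hl.symm.trans ((congrArg (fun x => p * x * p) h).trans hr)
  linear_combination (norm := module) (2 : ℚ) • key


/-- In an associative unital ℚ-algebra, the singlet-projector relations on three distinct
indices imply `4 · h_{ij} h_{jk} h_{ij} = h_{ij}`. -/
theorem stmt1 {R : Type*} [Ring R] [Algebra ℚ R]
    (hij hjk hik : R)
    (idem_ij : hij ^ 2 = hij) (idem_jk : hjk ^ 2 = hjk) (idem_ik : hik ^ 2 = hik)
    (anti_ijk : hij * hjk + hjk * hij = (1/2 : ℚ) • (hij + hjk - hik))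
    (anti_jik : hij * hik + hik * hij = (1/2 : ℚ) • (hij + hik - hjk))
    (anti_ikj : hik * hjk + hjk * hik = (1/2 : ℚ) • (hik + hjk - hij)) :
    (4 : R) * (hij * hjk * hij) = hij := by
  have h₁ := compress_anticommutation (by rwa [← sq]) anti_ijk
  have h₂ := compress_anticommutation (by rwa [← sq]) anti_jik
  have h : (4 : ℚ) • (hij * hjk * hij) = hij := by
    linear_combination (norm := module) (3 / 2 : ℚ) • h₁ - (1 / 2 : ℚ) • h₂
  rwa [Algebra.smul_def, map_ofNat] at h
end

section
/- Let R be an associative unital ℚ-algebra and let p, q, r ∈ R satisfy the SWAP relations for a triple of distinct indices i, j, k (with p = p_{ij}, q = p_{jk}, r = p_{ik}): p² = q² = r² = 1, and the three anticommutation relations p q + q p = p + q + r − 1, p r + r p = p + r + q − 1, q r + r q = q + r + p − 1. Then p q p = r and q p q = r; in particular the braid relation p q p = q p q holds. -/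
/-- Two of the SWAP anticommutation relations, those involving the involution `p`, already
determine the conjugate of `q` by `p`. -/
theorem conj_eq_of_swap_relations {R : Type*} [Ring R] [Algebra ℚ R] {p q r : R}
    (hp : p ^ 2 = 1)
    (hpq : p * q + q * p = p + q + r - 1)
    (hpr : p * r + r * p = p + r + q - 1) :
    p * q * p = r := by
  have hpp : p * p = 1 := by rw [← pow_two, hp]
  have hright : p * q * p + q = 1 + q * p + r * p - p := by
    simpa [add_mul, sub_mul, mul_assoc, hpp] using congrArg (· * p) hpq
  have hleft : q + p * q * p = 1 + p * q + p * r - p := by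
    simpa [mul_add, mul_sub, ← mul_assoc, hpp] using congrArg (p * ·) hpq
  linear_combination (norm := module) (2⁻¹ : ℚ) • (hright + hleft + hpq + hpr)

/-- In an associative unital ℚ-algebra, the SWAP relations for a triple of distinct indices
imply `p q p = r = q p q`; in particular the braid relation holds. -/
theorem stmt2 {R : Type*} [Ring R] [Algebra ℚ R]
    (p q r : R)
    (hp : p ^ 2 = 1) (hq : q ^ 2 = 1) (hr : r ^ 2 = 1)
    (hpq : p * q + q * p = p + q + r - 1)
    (hpr : p * r + r * p = p + r + q - 1)
    (hqr : q * r + r * q = q + r + p - 1) :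
    p * q * p = r ∧ q * p * q = r ∧ p * q * p = q * p * q := by
  have hpqp : p * q * p = r := conj_eq_of_swap_relations hp hpq hpr
  have hqpq : q * p * q = r :=
    conj_eq_of_swap_relations hq (by rw [add_comm, hpq, add_comm p q]) hqr
  exact ⟨hpqp, hqpq, hpqp.trans hqpq.symm⟩
end

section
/- Fix n ≥ 2 and nonnegative weights w_{ij} ≥ 0 for 1 ≤ i < j ≤ n. Let P_{ij} denote the concrete SWAP matrices on (ℂ²)^{⊗n} and let λ_min denote smallest eigenvalue. Then: (a) for every m ≥ 1, every family of Hermitian matrices Q_{ij} ∈ M_m(ℂ) (indexed by unordered pairs of distinct elements of {1,…,n}) satisfying Q_{ij}² = I for all pairs, Q_{ij} Q_{kl} = Q_{kl} Q_{ij} whenever {i,j} ∩ {k,l} = ∅, and Q_{ij} Q_{jk} + Q_{jk} Q_{ij} = Q_{ij} + Q_{jk} + Q_{ik} − I for all distinct i, j, k, and every unit vector g ∈ ℂ^m, one has ⟨g, (Σ_{i<j} w_{ij} Q_{ij}) g⟩ ≥ λ_min(Σ_{i<j} w_{ij} P_{ij}); and (b) this bound is attained (taking Q_{ij} = P_{ij}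 and g a minimal eigenvector). Hence the optimal value of the operator program 𝒫erm(V,w) equals λ_min of the concrete SWAP Hamiltonian Σ_{i<j} w_{ij} P_{ij}. -/
open Matrix Finset

noncomputable section

/-- The SWAP matrix on qubits indexed by `V`, exchanging tensor factors `i` and `j`. -/
def swapMat {V : Type*} [Fintype V] [DecidableEq V] (i j : V) :
    Matrix (V → Fin 2) (V → Fin 2) ℂ :=
  Matrix.of fun f g => if f ∘ (Equiv.swap i j) = g then 1 else 0

/-- The concrete SWAP Hamiltonian `Σ_{i<j} w_{ij} P_{ij}` on `n` qubits. -/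
def swapHam (n : ℕ) (w : Fin n → Fin n → ℝ) :
    Matrix (Fin n → Fin 2) (Fin n → Fin 2) ℂ :=
  ∑ i, ∑ j ∈ Finset.Ioi i, (w i j : ℂ) • swapMat i j

/-- The submonoid generated by the elements `p i j` with distinct `i, j ∈ S`. -/
def pairClosure {α M : Type*} [Monoid M] (p : α → α → M) (S : Finset α) : Submonoid M :=
  Submonoid.closure {x | ∃ i ∈ S, ∃ j ∈ S, i ≠ j ∧ x = p i j}

lemma mem_pairClosure {α M : Type*} [Monoid M] {p : α → α → M} {S : Finset α} {i j : α}
    (hi : i ∈ S) (hj : j ∈ S) (hij : i ≠ j) : p i j ∈ pairClosure p S :=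
  Submonoid.subset_closure ⟨i, hi, j, hj, hij, rfl⟩

/-- The defining relations of the transpositions in a symmetric group. -/
structure SwapRelations {α M : Type*} [DecidableEq α] [Monoid M] (p : α → α → M) : Prop where
  symm : ∀ i j, p i j = p j i
  sq : ∀ i j, i ≠ j → p i j * p i j = 1
  conj : ∀ i j k l, i ≠ j → k ≠ l →
    p i j * p k l = p (Equiv.swap i j k) (Equiv.swap i j l) * p i j

namespace SwapRelations

variable {α M : Type*} [DecidableEq α] [Monoid M]

lemma swap : SwapRelations (fun i j : α => Equiv.swap i j) where
  symm := Equiv.swap_comm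
  sq i j _ := Equiv.swap_mul_self i j
  conj i j k l _ _ := by
    rw [Equiv.swap_apply_apply, Equiv.swap_inv, mul_assoc, Equiv.swap_mul_self, mul_one]

lemma prod {N : Type*} [Monoid N] {p : α → α → M} {q : α → α → N}
    (hp : SwapRelations p) (hq : SwapRelations q) :
    SwapRelations (fun i j => (p i j, q i j)) where
  symm i j := by rw [hp.symm, hq.symm]
  sq i j h := by simp [hp.sq i j h, hq.sq i j h]
  conj i j k l h h' := by simp [hp.conj i j k l h h', hq.conj i j k l h h']

variable {p : α → α → M}

lemma mem_pairClosure_insert (hp : SwapRelations p) {S : Finset α} {a : α} (ha : a ∉ S) {x : M}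
    (hx : x ∈ pairClosure p (insert a S)) :
    x ∈ pairClosure p S ∨ ∃ b ∈ S, ∃ y ∈ pairClosure p S, x = y * p a b := by
  induction hx using Submonoid.closure_induction_right with
  | one => exact Or.inl (one_mem _)
  | mul_right x _ g hg ih =>
    obtain ⟨i, hi, j, hj, hij, rfl⟩ := hg
    have key : (∃ c ∈ S, p i j = p a c) ∨ (i ∈ S ∧ j ∈ S) := by
      rcases Finset.mem_insert.1 hi with rfl | hi'
      · exact Or.inl ⟨j, (Finset.mem_insert.1 hj).resolve_left hij.symm, rfl⟩
      · rcases Finset.mem_insert.1 hj with rfl | hj'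
        · exact Or.inl ⟨i, hi', hp.symm _ _⟩
        · exact Or.inr ⟨hi', hj'⟩
    have hne : ∀ {c}, c ∈ S → a ≠ c := fun hc h => ha (h ▸ hc)
    rcases key with ⟨c, hc, hpc⟩ | ⟨hi', hj'⟩
    · rw [hpc]
      rcases ih with ih | ⟨b, hb, y, hy, rfl⟩
      · exact Or.inr ⟨c, hc, x, ih, rfl⟩
      · rw [mul_assoc]
        rcases eq_or_ne b c with rfl | hbc
        · rw [hp.sq a b (hne hb), mul_one]
          exact Or.inl hy
        · refine Or.inr ⟨b, hb, y * p b c, mul_mem hy (mem_pairClosure hb hc hbc), ?_⟩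
          rw [hp.conj a b a c (hne hb) (hne hc), Equiv.swap_apply_left,
            Equiv.swap_apply_of_ne_of_ne (hne hc).symm hbc.symm, mul_assoc]
    · rcases ih with ih | ⟨b, hb, y, hy, rfl⟩
      · exact Or.inl (mul_mem ih (mem_pairClosure hi' hj' hij))
      · have hb' : Equiv.swap i j b ∈ S := by
          rw [Equiv.swap_apply_def]
          split_ifs <;> assumption
        refine Or.inr ⟨Equiv.swap i j b, hb', y * p i j,
          mul_mem hy (mem_pairClosure hi' hj' hij), ?_⟩
        rw [mul_assoc, mul_assoc, hp.conj i j a _ hij (hne hb'),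
          Equiv.swap_apply_of_ne_of_ne (hne hi') (hne hj'), Equiv.swap_apply_self]

lemma fst_apply_of_notMem {S : Finset α} {a : α} (ha : a ∉ S) {x : Equiv.Perm α × M}
    (hx : x ∈ pairClosure (fun i j => (Equiv.swap i j, p i j)) S) : x.1 a = a := by
  induction hx using Submonoid.closure_induction with
  | one => rfl
  | mul x y _ _ hx hy => simp [hx, hy]
  | mem x hx =>
    obtain ⟨i, hi, j, hj, -, rfl⟩ := hx
    exact Equiv.swap_apply_of_ne_of_ne (fun h => ha (h ▸ hi)) (fun h => ha (h ▸ hj))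

lemma eq_one_of_fst_eq_one (hp : SwapRelations p) (S : Finset α) :
    ∀ x ∈ pairClosure (fun i j => (Equiv.swap i j, p i j)) S, x.1 = 1 → x = 1 := by
  induction S using Finset.induction_on with
  | empty =>
    intro x hx _
    simpa [pairClosure] using hx
  | insert a S ha ih =>
    intro x hx h1
    rcases (swap.prod hp).mem_pairClosure_insert ha hx with h | ⟨b, hb, y, hy, rfl⟩
    · exact ih x h h1
    · exfalso
      have hab : y.1 b = a := by
        have := congrArg (fun σ : Equiv.Perm α => σ a) h1
        simpa using this
      have hya : y.1 a = a := fst_apply_of_notMem ha hy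
      exact ha (y.1.injective (hab.trans hya.symm) ▸ hb)

lemma exists_left_inv (hp : SwapRelations p) {S : Finset α} {x : M} (hx : x ∈ pairClosure p S) :
    ∃ y ∈ pairClosure p S, y * x = 1 := by
  induction hx using Submonoid.closure_induction with
  | one => exact ⟨1, one_mem _, one_mul _⟩
  | mul x y _ _ hx hy =>
    obtain ⟨x', hx', h1⟩ := hx
    obtain ⟨y', hy', h2⟩ := hy
    refine ⟨y' * x', mul_mem hy' hx', ?_⟩
    rw [mul_assoc, ← mul_assoc x', h1, one_mul, h2]
  | mem x hx =>
    obtain ⟨i, hi, j, hj, hij, rfl⟩ := hx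
    exact ⟨p i j, mem_pairClosure hi hj hij, hp.sq i j hij⟩

lemma eq_of_fst_eq (hp : SwapRelations p) {S : Finset α} {x y : Equiv.Perm α × M}
    (hx : x ∈ pairClosure (fun i j => (Equiv.swap i j, p i j)) S)
    (hy : y ∈ pairClosure (fun i j => (Equiv.swap i j, p i j)) S) (h : x.1 = y.1) : x = y := by
  obtain ⟨z, hz, hzx⟩ := (swap.prod hp).exists_left_inv hx
  obtain ⟨u, -, huz⟩ := (swap.prod hp).exists_left_inv hz
  have hzy : z * y = 1 := by
    apply hp.eq_one_of_fst_eq_one S _ (mul_mem hz hy)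
    rw [Prod.fst_mul, ← h, ← Prod.fst_mul, hzx, Prod.fst_one]
  rw [← one_mul x, ← huz, mul_assoc, hzx, ← hzy, ← mul_assoc, huz, one_mul]

/-- A family satisfying the relations of the transpositions extends to the symmetric group. -/
lemma exists_monoidHom [Fintype α] (hp : SwapRelations p) :
    ∃ ρ : Equiv.Perm α →* M, ∀ i j, i ≠ j → ρ (Equiv.swap i j) = p i j := by
  set H := pairClosure (fun i j => (Equiv.swap i j, p i j)) (Finset.univ : Finset α) with hH
  have hex : ∀ σ : Equiv.Perm α, ∃ x : M, (σ, x) ∈ H := by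
    intro σ
    have hσ : σ ∈ Submonoid.closure {σ : Equiv.Perm α | σ.IsSwap} := by
      rw [Equiv.Perm.mclosure_isSwap]
      trivial
    induction hσ using Submonoid.closure_induction with
    | one => exact ⟨1, one_mem H⟩
    | mul σ τ _ _ hσ hτ =>
      obtain ⟨x, hx⟩ := hσ
      obtain ⟨y, hy⟩ := hτ
      exact ⟨x * y, mul_mem hx hy⟩
    | mem σ hσ =>
      obtain ⟨i, j, hij, rfl⟩ := hσ
      exact ⟨p i j, mem_pairClosure (Finset.mem_univ i) (Finset.mem_univ j) hij⟩
  choose f hf using hex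
  have huniq : ∀ σ x, (σ, x) ∈ H → f σ = x := fun σ x hx =>
    congrArg Prod.snd (hp.eq_of_fst_eq (hf σ) hx rfl)
  refine ⟨⟨⟨f, huniq 1 1 (one_mem H)⟩, fun σ τ => huniq _ _ (mul_mem (hf σ) (hf τ))⟩,
    fun i j hij => huniq _ _ (mem_pairClosure (Finset.mem_univ i) (Finset.mem_univ j) hij)⟩

end SwapRelations

lemma mul_mul_eq_of_anticomm_relation {A : Type*} [Ring A] [StarRing A] [Algebra ℂ A]
    {a b c : A} (ha : a * a = 1) (hsa : star a = a) (hsb : star b = b) (hsc : star c = c)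
    (hab : a * b + b * a = a + b + c - 1) (hac : a * c + c * a = a + b + c - 1) :
    a * b * a = c := by
  have h1 : a * b * a = 1 - a - b + a * b + a * c := by
    have : a * (a * b + b * a) = a * (a + b + c - 1) := by rw [hab]
    simp only [mul_add, mul_sub, ← mul_assoc, ha, one_mul, mul_one] at this
    rw [← sub_eq_zero] at this ⊢
    rw [← this]
    abel
  have h2 : a * b * a = 1 - a - b + b * a + c * a := by
    have := congrArg star h1
    simpa [hsa, hsb, hsc, mul_assoc] using this
  have h3 : (2 : ℂ) • (a * b * a) = (2 : ℂ) • c := by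
    rw [two_smul, two_smul]
    calc a * b * a + a * b * a
        = (1 - a - b + a * b + a * c) + (1 - a - b + b * a + c * a) := by rw [← h1, ← h2]
      _ = (1 + 1) - (a + a) - (b + b) + (a * b + b * a) + (a * c + c * a) := by abel
      _ = c + c := by rw [hab, hac]; abel
  exact smul_right_injective A (two_ne_zero' ℂ) h3

/-- The relations of the operator program imply those of the transpositions. -/
lemma SwapRelations.of_anticomm_relation {α A : Type*} [DecidableEq α] [Ring A] [StarRing A]
    [Algebra ℂ A] {Q : α → α → A} (hsymm : ∀ i j, Q i j = Q j i)
    (hstar : ∀ i j, i ≠ j → star (Q i j) = Q i j) (hsq : ∀ i j, i ≠ j → Q i j ^ 2 = 1)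
    (hcomm : ∀ i j k l, i ≠ j → k ≠ l → i ≠ k → i ≠ l → j ≠ k → j ≠ l →
      Q i j * Q k l = Q k l * Q i j)
    (hrel : ∀ i j k, i ≠ j → j ≠ k → i ≠ k →
      Q i j * Q j k + Q j k * Q i j = Q i j + Q j k + Q i k - 1) : SwapRelations Q := by
  have hsq' : ∀ i j, i ≠ j → Q i j * Q i j = 1 := fun i j h => by rw [← pow_two, hsq i j h]
  have key : ∀ i j k, i ≠ j → j ≠ k → i ≠ k → Q i j * Q j k = Q i k * Q i j := by
    intro i j k hij hjk hik
    have hac := hrel j i k hij.symm hik hjk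
    rw [hsymm j i] at hac
    have h := mul_mul_eq_of_anticomm_relation (hsq' i j hij) (hstar i j hij) (hstar j k hjk)
      (hstar i k hik) (hrel i j k hij hjk hik) (hac.trans (by abel))
    rw [← h, mul_assoc, hsq' i j hij, mul_one]
  refine ⟨hsymm, hsq', fun i j k l hij hkl => ?_⟩
  by_cases hki : k = i
  · subst hki
    by_cases hlj : l = j
    · subst hlj
      simp [hsymm]
    · rw [Equiv.swap_apply_left, Equiv.swap_apply_of_ne_of_ne hkl.symm hlj, hsymm k j]
      exact key j k l hij.symm hkl (Ne.symm hlj)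
  by_cases hkj : k = j
  · subst hkj
    by_cases hli : l = i
    · subst hli
      simp [hsymm]
    · rw [Equiv.swap_apply_right, Equiv.swap_apply_of_ne_of_ne hli hkl.symm]
      exact key i k l hij hkl (Ne.symm hli)
  rw [Equiv.swap_apply_of_ne_of_ne hki hkj]
  by_cases hli : l = i
  · subst hli
    rw [Equiv.swap_apply_left, hsymm l j, hsymm k l, hsymm k j]
    exact key j l k hij.symm hkl.symm (Ne.symm hkj)
  by_cases hlj : l = j
  · subst hlj
    rw [Equiv.swap_apply_right, hsymm k l, hsymm k i]
    exact key i l k hij hkl.symm (Ne.symm hki)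
  rw [Equiv.swap_apply_of_ne_of_ne hli hlj]
  exact hcomm i j k l hij hkl (Ne.symm hki) (Ne.symm hli) (Ne.symm hkj) (Ne.symm hlj)

/-- The action of a permutation of the tensor factors on qubits indexed by `V`. -/
def permMat (V : Type*) [Fintype V] [DecidableEq V] :
    Equiv.Perm V →* Matrix (V → Fin 2) (V → Fin 2) ℂ where
  toFun σ := Matrix.of fun f g => if f ∘ σ = g then 1 else 0
  map_one' := by
    ext f g
    simp [Matrix.one_apply]
  map_mul' σ τ := by
    ext f g
    rw [Matrix.mul_apply, Finset.sum_eq_single (f ∘ σ)]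
    · simp only [Matrix.of_apply, if_true, one_mul]
      rfl
    · intro h _ hh
      simp [hh.symm]
    · simp

lemma comp_swap_eq_self {V : Type*} [DecidableEq V] {f : V → Fin 2} {i j : V} (h : f i = f j) :
    f ∘ Equiv.swap i j = f := by
  ext x
  rcases eq_or_ne x i with rfl | hi
  · simp [h]
  rcases eq_or_ne x j with rfl | hj
  · simp [h]
  simp [Equiv.swap_apply_of_ne_of_ne hi hj]

section permMat

variable {V : Type*} [Fintype V] [DecidableEq V]

lemma permMat_apply (σ : Equiv.Perm V) (f g : V → Fin 2) :
    permMat V σ f g = if f ∘ σ = g then 1 else 0 := rfl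

lemma permMat_swap (i j : V) : permMat V (Equiv.swap i j) = swapMat i j := rfl

lemma permMat_mul_apply_of_comp_eq {σ : Equiv.Perm V} {f : V → Fin 2} (h : f ∘ σ = f)
    (τ : Equiv.Perm V) (g : V → Fin 2) : permMat V (σ * τ) f g = permMat V τ f g := by
  simp [permMat_apply, ← Function.comp_assoc, h]

lemma swapMat_isHermitian (i j : V) : (swapMat i j).IsHermitian := by
  have h : ∀ f g : V → Fin 2, f ∘ Equiv.swap i j = g ↔ g ∘ Equiv.swap i j = f := by
    have h' : ∀ f g : V → Fin 2, f ∘ Equiv.swap i j = g → g ∘ Equiv.swap i j = f := by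
      rintro f _ rfl
      ext x
      simp
    exact fun f g => ⟨h' f g, h' g f⟩
  ext f g
  simp only [swapMat, Matrix.conjTranspose_apply, Matrix.of_apply, h f g]
  split_ifs <;> simp

/-- On qubits the antisymmetrizer of three tensor factors vanishes. -/
lemma swapMat_anticomm_relation {i j k : V} (hij : i ≠ j) (hjk : j ≠ k) (hik : i ≠ k) :
    swapMat i j * swapMat j k + swapMat j k * swapMat i j =
      swapMat i j + swapMat j k + swapMat i k - 1 := by
  have c1 : Equiv.swap j k * Equiv.swap i j = Equiv.swap i j * Equiv.swap i k := by
    rw [SwapRelations.swap.conj i j i k hij hik]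
    simp [Equiv.swap_apply_of_ne_of_ne hik.symm hjk.symm]
  have c2 : Equiv.swap i j * Equiv.swap j k = Equiv.swap j k * Equiv.swap i k := by
    rw [SwapRelations.swap.conj j k i k hjk hik]
    simp [Equiv.swap_apply_of_ne_of_ne hij hik]
  have c3 : Equiv.swap i j * Equiv.swap j k = Equiv.swap i k * Equiv.swap i j := by
    rw [SwapRelations.swap.conj i j j k hij hjk]
    simp [Equiv.swap_apply_of_ne_of_ne hik.symm hjk.symm]
  have c4 : Equiv.swap j k * Equiv.swap i j = Equiv.swap i k * Equiv.swap j k := by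
    rw [SwapRelations.swap.conj j k i j hjk hij]
    simp [Equiv.swap_apply_of_ne_of_ne hij hik]
  simp only [← permMat_swap, ← map_mul]
  rw [← map_one (permMat V)]
  ext f g
  have hone : ∀ {x y : V}, f x = f y →
      permMat V (Equiv.swap x y) f g = permMat V 1 f g := fun h => by
    simpa using permMat_mul_apply_of_comp_eq (comp_swap_eq_self h) 1 g
  have htwo : ∀ {x y : V}, f x = f y → ∀ τ, permMat V (Equiv.swap x y * τ) f g =
      permMat V τ f g := fun h τ => permMat_mul_apply_of_comp_eq (comp_swap_eq_self h) τ g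
  simp only [Matrix.add_apply, Matrix.sub_apply]
  have hcases : f i = f j ∨ f j = f k ∨ f i = f k := by
    generalize f i = a, f j = b, f k = c
    revert a b c
    decide
  rcases hcases with h | h | h
  · rw [c1, htwo h, htwo h, hone h]
    ring
  · rw [c2, htwo h, htwo h, hone h]
    ring
  · rw [c3, c4, htwo h, htwo h, hone h]
    ring

end permMat

/-- A permutation avoids the pattern `321`. -/
def Avoids321 {n : ℕ} (σ : Equiv.Perm (Fin n)) : Prop :=
  ∀ i j k, i < j → j < k → σ j < σ i → σ k < σ j → False

lemma toLex_mul_swap_lt {n : ℕ} (σ : Equiv.Perm (Fin n)) {a b : Fin n} (hab : a < b)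
    (h : σ b < σ a) :
    toLex ((σ * Equiv.swap a b : Equiv.Perm (Fin n)) : Fin n → Fin n) < toLex (σ : Fin n → Fin n) :=
  ⟨a, fun x hx => by simp [Equiv.swap_apply_of_ne_of_ne hx.ne (hx.trans hab).ne], by simpa using h⟩

/-- If the antisymmetrizers of three letters vanish, permutations avoiding `321` suffice to span. -/
lemma mem_span_avoids321 {n : ℕ} {A : Type*} [Ring A] [Algebra ℂ A]
    (ρ : Equiv.Perm (Fin n) →* A)
    (hrel : ∀ i j k, i ≠ j → j ≠ k → i ≠ k →
      ρ (Equiv.swap i j) * ρ (Equiv.swap j k) + ρ (Equiv.swap j k) * ρ (Equiv.swap i j) =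
        ρ (Equiv.swap i j) + ρ (Equiv.swap j k) + ρ (Equiv.swap i k) - 1)
    (σ : Equiv.Perm (Fin n)) : ρ σ ∈ Submodule.span ℂ (ρ '' {π | Avoids321 π}) := by
  have hwf : WellFounded fun σ τ : Equiv.Perm (Fin n) =>
      toLex (σ : Fin n → Fin n) < toLex (τ : Fin n → Fin n) :=
    InvImage.wf (fun σ : Equiv.Perm (Fin n) => toLex (σ : Fin n → Fin n))
      (wellFounded_lt (α := Lex (Fin n → Fin n)))
  induction σ using hwf.induction with
  | _ σ ih =>
  by_cases hσ : Avoids321 σ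
  · exact Submodule.subset_span ⟨σ, hσ, rfl⟩
  simp only [Avoids321, not_forall] at hσ
  obtain ⟨i, j, k, hij, hjk, h1, h2, -⟩ := hσ
  have hik := hij.trans hjk
  have h := congrArg (ρ σ * ·) (hrel i j k hij.ne hjk.ne hik.ne)
  simp only [mul_add, mul_sub, ← map_mul, ← mul_assoc, mul_one] at h
  have hij' := toLex_mul_swap_lt σ hij h1
  have hjk' := toLex_mul_swap_lt σ hjk h2
  have hik' := toLex_mul_swap_lt σ hik (h2.trans h1)
  have hijk := toLex_mul_swap_lt (σ * Equiv.swap i j) hjk (by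
    simpa [Equiv.swap_apply_of_ne_of_ne hik.ne' hjk.ne'] using h2.trans h1)
  have hjki := toLex_mul_swap_lt (σ * Equiv.swap j k) hij (by
    simpa [Equiv.swap_apply_of_ne_of_ne hij.ne hik.ne] using h2.trans h1)
  have hσ : ρ σ = ρ (σ * Equiv.swap i j) + ρ (σ * Equiv.swap j k) + ρ (σ * Equiv.swap i k) -
      (ρ (σ * Equiv.swap i j * Equiv.swap j k) + ρ (σ * Equiv.swap j k * Equiv.swap i j)) := by
    rw [h]
    abel
  rw [hσ]
  exact sub_mem (add_mem (add_mem (ih _ hij') (ih _ hjk')) (ih _ hik'))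
    (add_mem (ih _ (hijk.trans hij')) (ih _ (hjki.trans hjk')))

/-- A permutation avoiding `321` is increasing on each class of some two-colouring. -/
lemma Avoids321.exists_coloring {n : ℕ} {π : Equiv.Perm (Fin n)} (hπ : Avoids321 π) :
    ∃ f : Fin n → Fin 2, ∀ i j, i < j → f i = f j → π i < π j := by
  classical
  refine ⟨fun i => if ∃ j, i < j ∧ π j < π i then 1 else 0, fun i j hij hf => ?_⟩
  by_contra hlt
  have hji : π j < π i := lt_of_le_of_ne (not_lt.1 hlt) fun h => hij.ne' (π.injective h)
  have hi : ∃ j, i < j ∧ π j < π i := ⟨j, hij, hji⟩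
  by_cases hj : ∃ k, j < k ∧ π k < π j
  · obtain ⟨k, hjk, hkj⟩ := hj
    exact hπ i j k hij hjk hji hkj
  · simp [hi, hj] at hf

lemma toLex_le_of_coloring {n : ℕ} {π σ : Equiv.Perm (Fin n)} {f : Fin n → Fin 2}
    (hf : ∀ i j, i < j → f i = f j → π i < π j) (hσ : (f ∘ π.symm) ∘ σ = f) :
    toLex (π : Fin n → Fin n) ≤ toLex (σ : Fin n → Fin n) := by
  by_contra hlt
  obtain ⟨i, hi, hlt'⟩ : Pi.Lex (· < ·) (· < ·) (σ : Fin n → Fin n) π := not_le.1 hlt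
  obtain ⟨j, hj⟩ := π.surjective (σ i)
  have hfj : f j = f i := by
    have := congrFun hσ i
    simpa [← hj] using this
  rcases lt_trichotomy i j with hij | rfl | hij
  · exact lt_asymm (hf i j hij hfj.symm) (hj ▸ hlt')
  · exact hlt'.ne hj.symm
  · exact hij.ne (σ.injective ((hi j hij).trans hj))

/-- The SWAP representation of permutations avoiding `321` is linearly independent. -/
lemma linearIndepOn_permMat (n : ℕ) :
    LinearIndepOn ℂ (permMat (Fin n)) {π | Avoids321 π} := by
  rw [linearIndepOn_iff]
  intro c hc hsum
  by_contra hne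
  obtain ⟨π, hπ, hmax⟩ := c.support.exists_max_image
    (fun σ : Equiv.Perm (Fin n) => toLex (σ : Fin n → Fin n)) (Finsupp.support_nonempty_iff.2 hne)
  obtain ⟨f, hf⟩ := (hc hπ : Avoids321 π).exists_coloring
  have hentry := congrFun (congrFun hsum (f ∘ π.symm)) f
  rw [Finsupp.linearCombination_apply, Finsupp.sum, Matrix.sum_apply,
    Finset.sum_eq_single π] at hentry
  · have hone : (f ∘ π.symm) ∘ π = f := by ext x; simp
    simp only [Matrix.smul_apply, permMat_apply, hone, if_true, smul_eq_mul, mul_one,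
      Matrix.zero_apply] at hentry
    exact Finsupp.mem_support_iff.1 hπ hentry
  · intro σ hσ hσπ
    rw [Matrix.smul_apply, permMat_apply, if_neg, smul_zero]
    intro h
    refine hσπ (Equiv.coe_fn_injective ?_)
    exact toLex_inj.1 (le_antisymm (hmax σ hσ) (toLex_le_of_coloring hf h))
  · exact fun h => absurd hπ h

/-- Linear relations among the SWAP operators hold in every representation in which the
antisymmetrizers of three letters vanish. -/
lemma snd_eq_zero_of_mem_span {n : ℕ} {A : Type*} [Ring A] [Algebra ℂ A]
    (ρ : Equiv.Perm (Fin n) →* A)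
    (hrel : ∀ i j k, i ≠ j → j ≠ k → i ≠ k →
      ρ (Equiv.swap i j) * ρ (Equiv.swap j k) + ρ (Equiv.swap j k) * ρ (Equiv.swap i j) =
        ρ (Equiv.swap i j) + ρ (Equiv.swap j k) + ρ (Equiv.swap i k) - 1)
    {x : Matrix (Fin n → Fin 2) (Fin n → Fin 2) ℂ × A}
    (hx : x ∈ Submodule.span ℂ (Set.range ((permMat (Fin n)).prod ρ))) (h0 : x.1 = 0) :
    x.2 = 0 := by
  have hle : Submodule.span ℂ (Set.range ((permMat (Fin n)).prod ρ)) ≤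
      Submodule.span ℂ ((permMat (Fin n)).prod ρ '' {π | Avoids321 π}) := by
    rw [Submodule.span_le]
    rintro _ ⟨σ, rfl⟩
    refine mem_span_avoids321 _ (fun i j k hij hjk hik => Prod.ext ?_ ?_) σ
    · simpa [permMat_swap] using swapMat_anticomm_relation hij hjk hik
    · simpa using hrel i j k hij hjk hik
  obtain ⟨c, hc, rfl⟩ := (Finsupp.mem_span_image_iff_linearCombination ℂ).1 (hle hx)
  have hfst : Finsupp.linearCombination ℂ (permMat (Fin n)) c = 0 := by
    rw [← h0, Finsupp.linearCombination_apply, Finsupp.linearCombination_apply, Finsupp.sum,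
      Finsupp.sum, Prod.fst_sum]
    rfl
  rw [linearIndepOn_iff.1 (linearIndepOn_permMat n) c hc hfst]
  simp

/-- Polynomial identities of the SWAP Hamiltonian hold in every representation in which the
antisymmetrizers of three letters vanish. -/
lemma aeval_eq_zero_of_aeval_swapHam_eq_zero {n : ℕ} {A : Type*} [Ring A] [Algebra ℂ A]
    (ρ : Equiv.Perm (Fin n) →* A)
    (hrel : ∀ i j k, i ≠ j → j ≠ k → i ≠ k →
      ρ (Equiv.swap i j) * ρ (Equiv.swap j k) + ρ (Equiv.swap j k) * ρ (Equiv.swap i j) =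
        ρ (Equiv.swap i j) + ρ (Equiv.swap j k) + ρ (Equiv.swap i k) - 1)
    (w : Fin n → Fin n → ℝ) {q : Polynomial ℂ} (hq : Polynomial.aeval (swapHam n w) q = 0) :
    Polynomial.aeval (∑ i, ∑ j ∈ Finset.Ioi i, (w i j : ℂ) • ρ (Equiv.swap i j)) q = 0 := by
  set Φ := (permMat (Fin n)).prod ρ with hΦ
  set S := Algebra.adjoin ℂ (Set.range Φ) with hS
  have hspan : Subalgebra.toSubmodule S = Submodule.span ℂ (Set.range Φ) := by
    rw [hS, Algebra.adjoin_eq_span, ← MonoidHom.coe_mrange, Submonoid.closure_eq]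
  set x := ∑ i, ∑ j ∈ Finset.Ioi i, (w i j : ℂ) • Φ (Equiv.swap i j) with hx
  have hxS : x ∈ S := sum_mem fun i _ => sum_mem fun j _ =>
    S.smul_mem (Algebra.subset_adjoin ⟨_, rfl⟩) _
  have hx1 : x.1 = swapHam n w := by
    simp [hx, hΦ, Prod.fst_sum, swapHam, permMat_swap]
  have hx2 : x.2 = ∑ i, ∑ j ∈ Finset.Ioi i, (w i j : ℂ) • ρ (Equiv.swap i j) := by
    simp [hx, hΦ, Prod.snd_sum]
  have hmem : Polynomial.aeval x q ∈ Submodule.span ℂ (Set.range Φ) := by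
    rw [← hspan]
    exact Algebra.adjoin_le (Set.singleton_subset_iff.2 hxS)
      (Polynomial.aeval_mem_adjoin_singleton ℂ x)
  have := snd_eq_zero_of_mem_span ρ hrel hmem
  rw [Polynomial.aeval_prod_apply, hx1, hx2] at this
  exact this hq

open scoped ComplexOrder in
/-- If the characteristic polynomial of `A` annihilates `B`, the eigenvalues of `B` are among
those of `A`, so the quadratic form of `B` is bounded below by the least eigenvalue of `A`. -/
lemma iInf_eigenvalues_le_re_of_aeval_charpoly_eq_zero {ι κ : Type*} [Fintype ι] [DecidableEq ι]
    [Fintype κ] [DecidableEq κ] {A : Matrix ι ι ℂ} (hA : A.IsHermitian) {B : Matrix κ κ ℂ}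
    (hB : B.IsHermitian) (h : Polynomial.aeval B A.charpoly = 0) {g : κ → ℂ}
    (hg : star g ⬝ᵥ g = 1) : (⨅ x, hA.eigenvalues x) ≤ (star g ⬝ᵥ (B *ᵥ g)).re := by
  set l := ⨅ x, hA.eigenvalues x with hl
  have hC : (B - (l : ℂ) • 1).IsHermitian := by
    refine hB.sub ?_
    rw [Matrix.IsHermitian, Matrix.conjTranspose_smul]
    simp
  have hpos : (B - (l : ℂ) • 1).PosSemidef := by
    rw [hC.posSemidef_iff_eigenvalues_nonneg]
    intro x
    set μ := hC.eigenvalues x with hμ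
    set v : κ → ℂ := (hC.eigenvectorBasis x).ofLp with hv
    have hv0 : v ≠ 0 := by
      have := hC.eigenvectorBasis.orthonormal.ne_zero x
      simpa [hv] using this
    have hBv : Matrix.toLinAlgEquiv' B v = ((μ + l : ℝ) : ℂ) • v := by
      have := hC.mulVec_eigenvectorBasis x
      rw [Matrix.sub_mulVec, Matrix.smul_mulVec, Matrix.one_mulVec, sub_eq_iff_eq_add] at this
      rw [Matrix.toLinAlgEquiv'_apply, this, ← hμ, ← hv]
      ext y
      simp [add_mul]
    have hev := Module.End.aeval_apply_of_mem_apply_eq_smul (p := A.charpoly) hBv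
    rw [Polynomial.aeval_algEquiv, AlgHom.comp_apply] at hev
    simp only [h, map_zero, LinearMap.zero_apply] at hev
    have hroot := (smul_eq_zero.1 hev.symm).resolve_right hv0
    rw [hA.charpoly_eq, Polynomial.eval_prod, Finset.prod_eq_zero_iff] at hroot
    obtain ⟨y, -, hy⟩ := hroot
    rw [Polynomial.eval_sub, Polynomial.eval_X, Polynomial.eval_C, sub_eq_zero] at hy
    have hy' : μ + l = hA.eigenvalues y := Complex.ofReal_injective hy
    have hle : l ≤ hA.eigenvalues y := ciInf_le (Set.finite_range _).bddBelow y
    change 0 ≤ μ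
    linarith
  have := hpos.re_dotProduct_nonneg g
  rw [Matrix.sub_mulVec, Matrix.smul_mulVec, Matrix.one_mulVec, dotProduct_sub,
    dotProduct_smul, hg] at this
  simpa using this

/-- The least eigenvalue of a Hermitian matrix is the value of its quadratic form at a unit
vector. -/
lemma exists_dotProduct_mulVec_eq_iInf_eigenvalues {ι : Type*} [Fintype ι] [DecidableEq ι]
    [Nonempty ι] {A : Matrix ι ι ℂ} (hA : A.IsHermitian) :
    ∃ v : ι → ℂ, star v ⬝ᵥ v = 1 ∧ star v ⬝ᵥ (A *ᵥ v) = ((⨅ x, hA.eigenvalues x : ℝ) : ℂ) := by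
  obtain ⟨x, hx⟩ := exists_eq_ciInf_of_finite (f := hA.eigenvalues)
  have hv : star (hA.eigenvectorBasis x).ofLp ⬝ᵥ (hA.eigenvectorBasis x).ofLp = 1 := by
    rw [dotProduct_comm, ← EuclideanSpace.inner_eq_star_dotProduct]
    simp
  refine ⟨(hA.eigenvectorBasis x).ofLp, hv, ?_⟩
  rw [hA.mulVec_eigenvectorBasis, dotProduct_smul, hv, hx]
  simp

/-- The optimal value of the operator program `𝒫erm(V,w)` equals the smallest eigenvalue of
the concrete SWAP Hamiltonian `Σ_{i<j} w_{ij} P_{ij}`. -/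
theorem stmt3 (n : ℕ) (hn : 2 ≤ n) (w : Fin n → Fin n → ℝ) (hw : ∀ i j, 0 ≤ w i j)
    (hH : (swapHam n w).IsHermitian) :
    (∀ (m : ℕ), 1 ≤ m → ∀ Q : Fin n → Fin n → Matrix (Fin m) (Fin m) ℂ,
      (∀ i j, Q i j = Q j i) →
      (∀ i j, i ≠ j → (Q i j).IsHermitian) →
      (∀ i j, i ≠ j → Q i j ^ 2 = 1) →
      (∀ i j k l, i ≠ j → k ≠ l → i ≠ k → i ≠ l → j ≠ k → j ≠ l →
        Q i j * Q k l = Q k l * Q i j) →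
      (∀ i j k, i ≠ j → j ≠ k → i ≠ k →
        Q i j * Q j k + Q j k * Q i j = Q i j + Q j k + Q i k - 1) →
      ∀ g : Fin m → ℂ, star g ⬝ᵥ g = 1 →
        (⨅ x, hH.eigenvalues x) ≤
          (star g ⬝ᵥ ((∑ i, ∑ j ∈ Finset.Ioi i, (w i j : ℂ) • Q i j) *ᵥ g)).re) ∧
    (∃ (m : ℕ), 1 ≤ m ∧ ∃ Q : Fin n → Fin n → Matrix (Fin m) (Fin m) ℂ,
      (∀ i j, Q i j = Q j i) ∧
      (∀ i j, i ≠ j → (Q i j).IsHermitian) ∧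
      (∀ i j, i ≠ j → Q i j ^ 2 = 1) ∧
      (∀ i j k l, i ≠ j → k ≠ l → i ≠ k → i ≠ l → j ≠ k → j ≠ l →
        Q i j * Q k l = Q k l * Q i j) ∧
      (∀ i j k, i ≠ j → j ≠ k → i ≠ k →
        Q i j * Q j k + Q j k * Q i j = Q i j + Q j k + Q i k - 1) ∧
      ∃ g : Fin m → ℂ, star g ⬝ᵥ g = 1 ∧
        star g ⬝ᵥ ((∑ i, ∑ j ∈ Finset.Ioi i, (w i j : ℂ) • Q i j) *ᵥ g) =
          ((⨅ x, hH.eigenvalues x : ℝ) : ℂ)) := by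
  classical
  refine ⟨?_, ?_⟩
  · intro m _ Q hsymm hherm hsq hcomm hrel g hg
    obtain ⟨ρ, hρ⟩ :=
      (SwapRelations.of_anticomm_relation hsymm hherm hsq hcomm hrel).exists_monoidHom
    have hham : ∑ i, ∑ j ∈ Finset.Ioi i, (w i j : ℂ) • Q i j =
        ∑ i, ∑ j ∈ Finset.Ioi i, (w i j : ℂ) • ρ (Equiv.swap i j) :=
      Finset.sum_congr rfl fun i _ => Finset.sum_congr rfl fun j hj => by
        rw [hρ i j (Finset.mem_Ioi.1 hj).ne]
    refine iInf_eigenvalues_le_re_of_aeval_charpoly_eq_zero hH ?_ ?_ hg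
    · rw [Matrix.IsHermitian, Matrix.conjTranspose_sum]
      refine Finset.sum_congr rfl fun i _ => ?_
      rw [Matrix.conjTranspose_sum]
      refine Finset.sum_congr rfl fun j hj => ?_
      rw [Matrix.conjTranspose_smul, (hherm i j (Finset.mem_Ioi.1 hj).ne).eq]
      simp
    · rw [hham]
      refine aeval_eq_zero_of_aeval_swapHam_eq_zero ρ (fun i j k hij hjk hik => ?_) w
        (Matrix.aeval_self_charpoly _)
      rw [hρ i j hij, hρ j k hjk, hρ i k hik, hrel i j k hij hjk hik]
  · let e := Fintype.equivFin (Fin n → Fin 2)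
    let E := Matrix.reindexAlgEquiv ℂ ℂ e
    obtain ⟨v, hv, hmin⟩ := exists_dotProduct_mulVec_eq_iInf_eigenvalues hH
    have hE : ∑ i, ∑ j ∈ Finset.Ioi i, (w i j : ℂ) • E (swapMat i j) = E (swapHam n w) := by
      simp only [swapHam, map_sum, map_smul]
    refine ⟨_, Fintype.card_pos, fun i j => E (swapMat i j), ?_, ?_, ?_, ?_, ?_, v ∘ e.symm, ?_, ?_⟩
    · intro i j
      simp only [← permMat_swap, Equiv.swap_comm]
    · exact fun i j _ => (swapMat_isHermitian i j).submatrix _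
    · intro i j _
      rw [← map_pow, sq, ← permMat_swap, ← map_mul, Equiv.swap_mul_self, map_one, map_one]
    · intro i j k l hij hkl hik hil hjk hjl
      simp only [← map_mul, ← permMat_swap]
      rw [SwapRelations.swap.conj i j k l hij hkl, Equiv.swap_apply_of_ne_of_ne hik.symm hjk.symm,
        Equiv.swap_apply_of_ne_of_ne hil.symm hjl.symm]
    · intro i j k hij hjk hik
      simp only [← map_mul, ← map_add, swapMat_anticomm_relation hij hjk hik, map_sub, map_one]
    · exact (comp_equiv_dotProduct_comp_equiv (star v) v e.symm).trans hv
    · rw [hE, ← hmin]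
      change star (v ∘ e.symm) ⬝ᵥ ((swapHam n w).submatrix e.symm e.symm *ᵥ (v ∘ e.symm)) = _
      rw [Matrix.submatrix_mulVec_equiv]
      have hcomp : (v ∘ e.symm) ∘ e.symm.symm = v := by
        ext x
        simp
      rw [hcomp]
      exact comp_equiv_dotProduct_comp_equiv (star v) (swapHam n w *ᵥ v) e.symm

end
end

section
/- Fix n ≥ 2 and nonnegative weights w_e ≥ 0 indexed by unordered pairs e of distinct elements of {1,…,n}. Then the supremum of Σ_e w_e · M(I, h_e) over all (complex) NPA₁(Proj) moment matrices M on n sites equals the supremum of the same objective over all real NPA₁(Proj) moment matrices on n sites. That is, the first level of the complex NPA hierarchy for Quantum Max Cut in the projector basis has the same optimal value as its real variant. -/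
open Matrix Finset
open scoped ComplexOrder

noncomputable section

/-- Unordered pairs of distinct elements of `V`. -/
def PairIdx (V : Type*) := {e : Sym2 V // ¬ e.IsDiag}

instance {V : Type*} [DecidableEq V] [Fintype V] : Fintype (PairIdx V) :=
  Subtype.fintype _

instance {V : Type*} [DecidableEq V] : DecidableEq (PairIdx V) :=
  Subtype.instDecidableEq

/-- Index set for a level-1 projector moment matrix: the symbol `I` (`none`) together with
all unordered pairs of distinct sites. -/
abbrev MIdx (V : Type*) := Option (PairIdx V)

/-- The unordered pair `{i, j}` for distinct `i ≠ j`. -/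
def pr {V : Type*} (i j : V) (h : i ≠ j) : PairIdx V :=
  ⟨s(i, j), by simpa using h⟩

/-- A (complex) `NPA₁(Proj)` moment matrix on sites `V`. -/
def IsMomentMatrix {V : Type*} [Fintype V] [DecidableEq V]
    (M : Matrix (MIdx V) (MIdx V) ℂ) : Prop :=
  M.PosSemidef ∧
  M none none = 1 ∧
  (∀ e : PairIdx V, M (some e) (some e) = M none (some e)) ∧
  (∀ e f : PairIdx V, (∀ x : V, x ∈ e.1 → x ∉ f.1) →
      M (some e) (some f) = M (some f) (some e)) ∧
  (∀ i j k : V, ∀ hij : i ≠ j, ∀ hjk : j ≠ k, ∀ hik : i ≠ k,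
      M (some (pr i j hij)) (some (pr j k hjk)) +
        M (some (pr j k hjk)) (some (pr i j hij)) =
      (M none (some (pr i j hij)) + M none (some (pr j k hjk)) -
        M none (some (pr i k hik))) / 2)

/-- The entrywise real part of a positive semidefinite complex matrix is positive semidefinite. -/
theorem Matrix.PosSemidef.map_re {m : Type*} [Fintype m] {M : Matrix m m ℂ}
    (hM : M.PosSemidef) : (M.map fun z => (z.re : ℂ)).PosSemidef := by
  have key : (M.map fun z => (z.re : ℂ)) = (1 / 2 : ℂ) • (M + Mᵀ) := by
    ext a b
    have h : M b a = (starRingEnd ℂ) (M a b) := (hM.1.apply b a).symm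
    simp [h, Complex.re_eq_add_conj]
    ring
  rw [key]
  exact (hM.add hM.transpose).smul (by norm_num [Complex.le_def])

/-- The entrywise real part of a moment matrix is a moment matrix. -/
theorem IsMomentMatrix.map_re {V : Type*} [Fintype V] [DecidableEq V]
    {M : Matrix (MIdx V) (MIdx V) ℂ} (hM : IsMomentMatrix M) :
    IsMomentMatrix (M.map fun z => (z.re : ℂ)) := by
  obtain ⟨hpos, hone, hproj, hcomm, hanti⟩ := hM
  refine ⟨hpos.map_re, by simp [hone], fun e => by simp [hproj e],
    fun e f hef => by simp [hcomm e f hef], fun i j k hij hjk hik => ?_⟩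
  have h := congrArg Complex.re (hanti i j k hij hjk hik)
  simp only [Complex.add_re, Complex.sub_re, Complex.div_ofNat_re] at h
  simp only [Matrix.map_apply]
  exact_mod_cast congrArg Complex.ofReal h

/-- The first level of the complex NPA hierarchy for Quantum Max Cut in the projector basis
has the same optimal value as its real variant. -/
theorem stmt4 (n : ℕ) (hn : 2 ≤ n) (w : PairIdx (Fin n) → ℝ) (hw : ∀ e, 0 ≤ w e) :
    sSup {x : ℝ | ∃ M : Matrix (MIdx (Fin n)) (MIdx (Fin n)) ℂ, IsMomentMatrix M ∧
        x = ∑ e : PairIdx (Fin n), w e * (M none (some e)).re} =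
    sSup {x : ℝ | ∃ M : Matrix (MIdx (Fin n)) (MIdx (Fin n)) ℂ, IsMomentMatrix M ∧
        (∀ a b, (M a b).im = 0) ∧
        x = ∑ e : PairIdx (Fin n), w e * (M none (some e)).re} := by
  congr 1
  ext x
  constructor
  · rintro ⟨M, hM, rfl⟩
    exact ⟨_, hM.map_re, fun a b => by simp, by simp⟩
  · rintro ⟨M, hM, -, hx⟩
    exact ⟨M, hM, hx⟩

end
end

section
/- Let M be a real NPA₁(Proj) moment matrix on n sites and let i, j, k be distinct elements of {1,…,n}. Write a = M(I,h_{ij}), b = M(I,h_{jk}), c = M(I,h_{ik}), and suppose the monogamy-of-entanglement inequality a² + b² + c² ≤ 2(ab + bc + ca) holds. Then 4 · M(h_{ij}, h_{jk})² ≤ M(I,h_{ij}) · M(I,h_{jk}). In particular, whenever M(I,h_{ij}) and M(I,h_{jk}) are nonzero, the normalized Gram vectors corresponding to the indices h_{ij} and h_{jk} have inner product of absolute value at most 1/2, i.e. the angle between them is at least 60° and at most 120°. -/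
open Matrix Finset
open scoped ComplexOrder

noncomputable section

/-- For a real `NPA₁(Proj)` moment matrix, the monogamy-of-entanglement inequality on a
triangle forces `4 M(h_{ij},h_{jk})² ≤ M(I,h_{ij}) M(I,h_{jk})`; in particular the normalized
Gram vectors of `h_{ij}` and `h_{jk}` have inner product of absolute value at most `1/2`. -/
theorem stmt5 (n : ℕ) (M : Matrix (MIdx (Fin n)) (MIdx (Fin n)) ℂ)
    (hM : IsMomentMatrix M) (hreal : ∀ a b, (M a b).im = 0)
    (i j k : Fin n) (hij : i ≠ j) (hjk : j ≠ k) (hik : i ≠ k)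
    (hmono : (M none (some (pr i j hij))).re ^ 2 + (M none (some (pr j k hjk))).re ^ 2 +
        (M none (some (pr i k hik))).re ^ 2 ≤
      2 * ((M none (some (pr i j hij))).re * (M none (some (pr j k hjk))).re +
        (M none (some (pr j k hjk))).re * (M none (some (pr i k hik))).re +
        (M none (some (pr i k hik))).re * (M none (some (pr i j hij))).re)) :
    4 * (M (some (pr i j hij)) (some (pr j k hjk))).re ^ 2 ≤
      (M none (some (pr i j hij))).re * (M none (some (pr j k hjk))).re ∧
    ((M none (some (pr i j hij))).re ≠ 0 → (M none (some (pr j k hjk))).re ≠ 0 →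
      |(M (some (pr i j hij)) (some (pr j k hjk))).re| /
        Real.sqrt ((M none (some (pr i j hij))).re * (M none (some (pr j k hjk))).re)
        ≤ 1 / 2) := by
  obtain ⟨hpsd, -, -, -, htri⟩ := hM
  have hsymm : (M (some (pr j k hjk)) (some (pr i j hij))).re =
      (M (some (pr i j hij)) (some (pr j k hjk))).re := by
    rw [← hpsd.isHermitian.apply (some (pr j k hjk)) (some (pr i j hij))]
    simp
  have hre := congrArg Complex.re (htri i j k hij hjk hik)
  rw [Complex.add_re, hsymm, Complex.div_ofNat_re, Complex.sub_re, Complex.add_re] at hre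
  generalize (M (some (pr i j hij)) (some (pr j k hjk))).re = m at *
  generalize (M none (some (pr i j hij))).re = a at *
  generalize (M none (some (pr j k hjk))).re = b at *
  generalize (M none (some (pr i k hik))).re = c at *
  have hc : c = a + b - 4 * m := by linarith
  have hsq : 4 * m ^ 2 ≤ a * b := by
    subst hc
    nlinarith
  refine ⟨hsq, fun ha hb => ?_⟩
  have hab : 0 < a * b :=
    lt_of_le_of_ne (le_trans (by positivity) hsq) (mul_ne_zero ha hb).symm
  rw [div_le_iff₀ (Real.sqrt_pos.mpr hab)]
  have habs : |2 * m| ≤ √(a * b) := Real.abs_le_sqrt (by linarith)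
  rw [abs_mul, abs_two] at habs
  linarith

end
end

section
/- Fix n ≥ 1 and consider the uniform star Quantum Max Cut Hamiltonian H = Σ_{i=1}^n H_{0i} on n+1 qubits with sites {0,1,…,n}. Then the largest eigenvalue of H is exactly (n+1)/2. -/
open Matrix Finset
open scoped ComplexOrder

noncomputable section

/-- The singlet projector `H_{ij} = (I - P_{ij})/2`. -/
def singletProj {V : Type*} [Fintype V] [DecidableEq V] (i j : V) :
    Matrix (V → Fin 2) (V → Fin 2) ℂ :=
  (2 : ℂ)⁻¹ • (1 - swapMat i j)

/-- The action of the Hamiltonian on a vector: `(n+1)/2` minus half the sum of all swaps with `0`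
(the trivial one included). -/
lemma sum_singletProj_mulVec (n : ℕ) (v : (Fin (n + 1) → Fin 2) → ℂ) (f : Fin (n + 1) → Fin 2) :
    ((∑ i : Fin n, singletProj (0 : Fin (n + 1)) i.succ) *ᵥ v) f =
      ((n : ℂ) + 1) / 2 * v f - 2⁻¹ * ∑ i : Fin (n + 1), v (f ∘ Equiv.swap 0 i) := by
  have h (i : Fin n) : (singletProj (0 : Fin (n + 1)) i.succ *ᵥ v) f =
      2⁻¹ * (v f - v (f ∘ Equiv.swap 0 i.succ)) := by
    have hs : (swapMat (0 : Fin (n + 1)) i.succ *ᵥ v) f = v (f ∘ Equiv.swap 0 i.succ) := by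
      simp [swapMat, mulVec, dotProduct]
    simp [singletProj, smul_mulVec, sub_mulVec, hs]
  simp only [sum_mulVec, Finset.sum_apply, h]
  rw [Fin.sum_univ_succ, ← Finset.mul_sum, Finset.sum_sub_distrib]
  simp
  ring

/-- The number of sites agreeing with site `0`. -/
def agreeCount {n : ℕ} (f : Fin (n + 1) → Fin 2) : ℕ :=
  #{i | f i = f 0}

lemma agreeCount_pos {n : ℕ} (f : Fin (n + 1) → Fin 2) : 0 < agreeCount f :=
  Finset.card_pos.mpr ⟨0, by simp⟩

lemma agreeCount_swap {n : ℕ} (f : Fin (n + 1) → Fin 2) (i : Fin (n + 1)) (hi : f i ≠ f 0) :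
    agreeCount (f ∘ Equiv.swap 0 i) = #{j | f j ≠ f 0} := by
  refine Finset.card_equiv (Equiv.swap 0 i) fun j => ?_
  simp only [Finset.mem_filter, Finset.mem_univ, true_and, Function.comp_apply,
    Equiv.swap_apply_left]
  generalize f (Equiv.swap 0 i j) = a
  omega

lemma comp_swap_of_eq {α β : Type*} [DecidableEq α] (f : α → β) (i j : α) (h : f j = f i) :
    f ∘ Equiv.swap i j = f := by
  ext k
  rcases eq_or_ne k i with rfl | hi
  · simp [h]
  rcases eq_or_ne k j with rfl | hj
  · simp [h]
  simp [Equiv.swap_apply_of_ne_of_ne hi hj]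

/-- The sum of all swaps with `0` (the trivial one included) has no negative eigenvalue. -/
lemma nonneg_of_sum_swap_eq {n : ℕ} (v : (Fin (n + 1) → Fin 2) → ℂ) (hv : v ≠ 0) (μ : ℝ)
    (h : ∀ f, ∑ i : Fin (n + 1), v (f ∘ Equiv.swap 0 i) = μ * v f) : 0 ≤ μ := by
  obtain ⟨f, hf⟩ := Finite.exists_max fun f => (agreeCount f : ℝ) * ‖v f‖
  have hpos (g : Fin (n + 1) → Fin 2) : (0 : ℝ) < agreeCount g := by
    exact_mod_cast agreeCount_pos g
  have hvf : 0 < ‖v f‖ := by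
    obtain ⟨g, hg⟩ := Function.ne_iff.mp hv
    have h1 := hf g
    have h2 := mul_pos (hpos g) (norm_pos_iff.mpr hg)
    exact (pos_iff_pos_of_mul_pos (h2.trans_le h1)).mp (hpos f)
  by_contra! hμ
  have hsplit := h f
  rw [← Finset.sum_filter_add_sum_filter_not _ (fun i => f i = f 0)] at hsplit
  have hagree : ∑ i with f i = f 0, v (f ∘ Equiv.swap 0 i) = agreeCount f * v f := by
    rw [Finset.sum_congr rfl fun i hi => by
      rw [comp_swap_of_eq f 0 i (Finset.mem_filter.mp hi).2]]
    simp [agreeCount]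
  rw [hagree] at hsplit
  have hdis : ‖∑ i with ¬ f i = f 0, v (f ∘ Equiv.swap 0 i)‖ ≤ agreeCount f * ‖v f‖ := by
    rcases Finset.eq_empty_or_nonempty ({i | ¬ f i = f 0} : Finset (Fin (n + 1))) with he | he
    · rw [he]
      simp only [Finset.sum_empty, norm_zero]
      positivity
    have hd : (0 : ℝ) < #{i | ¬ f i = f 0} := by exact_mod_cast Finset.card_pos.mpr he
    calc _ ≤ ∑ i with ¬ f i = f 0, ‖v (f ∘ Equiv.swap 0 i)‖ := norm_sum_le _ _
      _ ≤ ∑ i with ¬ f i = f 0, agreeCount f * ‖v f‖ / #{i | ¬ f i = f 0} := by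
        refine Finset.sum_le_sum fun i hi => ?_
        have := hf (f ∘ Equiv.swap 0 i)
        rw [agreeCount_swap f i (Finset.mem_filter.mp hi).2] at this
        rw [le_div_iff₀ hd, mul_comm]
        exact this
      _ = _ := by
        rw [Finset.sum_const, nsmul_eq_mul]
        field_simp
  have heq : ∑ i with ¬ f i = f 0, v (f ∘ Equiv.swap 0 i) =
      ((μ - agreeCount f : ℝ) : ℂ) * v f := by
    push_cast
    linear_combination hsplit
  rw [heq, norm_mul, Complex.norm_real, Real.norm_eq_abs, abs_of_neg (by linarith [hpos f])] at hdis
  nlinarith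

/-- A vector in the kernel of the sum of all swaps with `0`, supported on configurations with
exactly one `1`. -/
def starGroundState (n : ℕ) (f : Fin (n + 1) → Fin 2) : ℂ :=
  if ∑ j, (f j : ℕ) = 1 then ((n : ℂ) + 1) * (f 0 : ℕ) - 1 else 0

lemma sum_starGroundState_swap (n : ℕ) (f : Fin (n + 1) → Fin 2) :
    ∑ i : Fin (n + 1), starGroundState n (f ∘ Equiv.swap 0 i) = 0 := by
  have h (i : Fin (n + 1)) : ∑ j, ((f ∘ Equiv.swap 0 i) j : ℕ) = ∑ j, (f j : ℕ) :=
    Equiv.sum_comp (Equiv.swap 0 i) fun j => (f j : ℕ)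
  simp only [starGroundState, h]
  split_ifs with hw
  · have hw' : ∑ j, ((f j : ℕ) : ℂ) = 1 := by exact_mod_cast hw
    simp [Finset.sum_sub_distrib, ← Finset.mul_sum, hw']
  · simp

lemma starGroundState_ne_zero {n : ℕ} (hn : 1 ≤ n) : starGroundState n ≠ 0 := by
  intro h
  have h1 := congrFun h (Pi.single 0 1)
  have hw : ∑ j, ((Pi.single (0 : Fin (n + 1)) (1 : Fin 2) : Fin (n + 1) → Fin 2) j : ℕ) = 1 := by
    rw [Finset.sum_eq_single 0] <;> simp +contextual
  simp [starGroundState, hw] at h1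
  omega

/-- The largest eigenvalue of the uniform star Quantum Max Cut Hamiltonian
`Σ_{i=1}^n H_{0i}` on `n+1` qubits is exactly `(n+1)/2`. -/
theorem stmt8 (n : ℕ) (hn : 1 ≤ n)
    (hH : (∑ i : Fin n, singletProj (0 : Fin (n+1)) i.succ).IsHermitian) :
    (⨆ x, hH.eigenvalues x) = ((n : ℝ) + 1) / 2 := by
  have hvec (v : (Fin (n + 1) → Fin 2) → ℂ) := sum_singletProj_mulVec n v
  refine le_antisymm (ciSup_le fun x => ?_) ?_
  · have hb := hH.mulVec_eigenvectorBasis x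
    have hne : (hH.eigenvectorBasis x).ofLp ≠ 0 := fun h0 =>
      hH.eigenvectorBasis.orthonormal.ne_zero x (by ext f; exact congrFun h0 f)
    have := nonneg_of_sum_swap_eq _ hne (n + 1 - 2 * hH.eigenvalues x) fun f => by
      have hf := congrFun hb f
      rw [hvec] at hf
      simp only [Pi.smul_apply, Complex.real_smul] at hf
      push_cast
      linear_combination -2 * hf
    linarith
  · have hmem : ((n : ℝ) + 1) / 2 ∈ Set.range hH.eigenvalues := by
      rw [← hH.spectrum_real_eq_range_eigenvalues, spectrum.mem_iff, Matrix.isUnit_iff_isUnit_det,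
        isUnit_iff_ne_zero, not_not, ← Matrix.exists_mulVec_eq_zero_iff]
      refine ⟨_, starGroundState_ne_zero hn, ?_⟩
      ext f
      rw [sub_mulVec, Pi.sub_apply, hvec, sum_starGroundState_swap, Algebra.algebraMap_eq_smul_one,
        smul_mulVec, one_mulVec]
      simp
    obtain ⟨x, hx⟩ := hmem
    rw [← hx]
    exact le_ciSup (Set.finite_range _).bddAbove x

end
end

section
/- Fix n ≥ 4 and set a := (n+2)/(4(n−1)) and b := n(n+2)/(16(n−1)(n−3)). Define the real symmetric matrix M with rows and columns indexed by a symbol I together with all unordered pairs e of distinct elements of {1,…,n}, by: M(I,I) = 1; M(I,h_e) = M(h_e,I) = M(h_e,h_e) = a for every pair e; M(h_e,h_f) = a/4 whenever e and f share exactly one element; and M(h_e,h_f) = b whenever e and f are disjoint. Then M is positive semidefinite and is an NPA₁(Proj) moment matrix on n sites, and its objective value on the uniform complete graph satisfies Σ_{1 ≤ i < j ≤ n} M(I,h_{ij}) = n(n+2)/8. Consequently the optimal value of NPA₁(Proj) on the complete graph with n vertices is exactly n(n+2)/8 (the matching upper bound being given by the level-1 sum-of-squares certificate). -/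
open Matrix Finset
open scoped ComplexOrder

noncomputable section

/-- The explicit level-1 moment matrix for the uniform complete graph on `n` vertices, with
`M(I,h_e) = M(h_e,h_e) = a := (n+2)/(4(n-1))`, `M(h_e,h_f) = a/4` when `e,f` share exactly
one element, and `M(h_e,h_f) = b := n(n+2)/(16(n-1)(n-3))` when `e,f` are disjoint. -/
def completeMM (n : ℕ) : Matrix (MIdx (Fin n)) (MIdx (Fin n)) ℂ :=
  Matrix.of fun r c =>
    match r, c with
    | none, none => 1
    | none, some _ => ((((n : ℝ) + 2) / (4 * ((n : ℝ) - 1)) : ℝ) : ℂ)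
    | some _, none => ((((n : ℝ) + 2) / (4 * ((n : ℝ) - 1)) : ℝ) : ℂ)
    | some e, some f =>
        if e = f then ((((n : ℝ) + 2) / (4 * ((n : ℝ) - 1)) : ℝ) : ℂ)
        else if ∀ x : Fin n, x ∈ e.1 → x ∉ f.1 then
          (((n : ℝ) * ((n : ℝ) + 2) / (16 * ((n : ℝ) - 1) * ((n : ℝ) - 3)) : ℝ) : ℂ)
        else ((((n : ℝ) + 2) / (16 * ((n : ℝ) - 1)) : ℝ) : ℂ)

section Incidence

variable {V : Type*}

lemma pr_comm (i j : V) (h : i ≠ j) : pr i j h = pr j i h.symm :=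
  Subtype.ext Sym2.eq_swap

lemma mem_pr {i j x : V} {h : i ≠ j} : x ∈ (pr i j h).1 ↔ x = i ∨ x = j := Sym2.mem_iff

lemma pr_right_injective {i j k : V} {hj : i ≠ j} {hk : i ≠ k} (h : pr i j hj = pr i k hk) :
    j = k := Sym2.congr_right.1 (congrArg Subtype.val h)

lemma exists_eq_pr (e : PairIdx V) : ∃ i j, ∃ h : i ≠ j, e = pr i j h := by
  obtain ⟨z, hz⟩ := e
  induction z using Sym2.ind with
  | _ i j => exact ⟨i, j, by simpa using hz, rfl⟩

lemma exists_eq_pr_of_mem {e : PairIdx V} {i : V} (hi : i ∈ e.1) :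
    ∃ j, ∃ h : i ≠ j, e = pr i j h := by
  obtain ⟨a, b, hab, rfl⟩ := exists_eq_pr e
  rcases mem_pr.1 hi with rfl | rfl
  · exact ⟨b, hab, rfl⟩
  · exact ⟨a, hab.symm, pr_comm _ _ _⟩

variable (V) in
/-- The all-ones matrix indexed by pairs. -/
def pairOnes : Matrix (PairIdx V) (PairIdx V) ℂ := Matrix.of fun _ _ => 1

lemma pairOnes_transpose : (pairOnes V)ᵀ = pairOnes V := rfl

variable [Fintype V] [DecidableEq V]

/-- A sum over the pairs containing `i`, reindexed by the other endpoint. -/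
lemma sum_mem_eq_sum_pr {R : Type*} [AddCommMonoid R] (i : V) (g : PairIdx V → R) :
    ∑ e : PairIdx V, (if i ∈ e.1 then g e else 0)
      = ∑ j, if h : i ≠ j then g (pr i j h) else 0 := by
  have key (e : PairIdx V) : (if i ∈ e.1 then g e else 0)
      = ∑ j, if h : i ≠ j then (if e = pr i j h then g (pr i j h) else 0) else 0 := by
    split_ifs with hi
    · obtain ⟨j, h, rfl⟩ := exists_eq_pr_of_mem hi
      rw [Finset.sum_eq_single j]
      · simp [h]
      · intro k _ hk
        split_ifs with h1 h2
        · exact absurd (pr_right_injective h2).symm hk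
        · rfl
        · rfl
      · simp
    · refine (Finset.sum_eq_zero fun j _ => ?_).symm
      split_ifs with h1 h2
      · exact absurd (h2 ▸ mem_pr.2 (Or.inl rfl)) hi
      · rfl
      · rfl
  simp_rw [key]
  rw [Finset.sum_comm]
  refine Finset.sum_congr rfl fun j _ => ?_
  split_ifs with h <;> simp

variable (V) in
/-- The pair-vertex incidence matrix of the complete graph on `V`. -/
def pairIncidence : Matrix (PairIdx V) V ℂ := Matrix.of fun e i => if i ∈ e.1 then 1 else 0

/-- Every pair has two elements. -/
lemma sum_mem_pair {R : Type*} [NonAssocSemiring R] (e : PairIdx V) :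
    ∑ i, (if i ∈ e.1 then 1 else 0 : R) = 2 := by
  obtain ⟨a, b, hab, rfl⟩ := exists_eq_pr e
  have h : univ.filter (fun i => i ∈ (pr a b hab).1) = {a, b} := by ext; simp [mem_pr]
  rw [Finset.sum_boole, h, Finset.card_pair hab, Nat.cast_ofNat]

lemma pairIncidence_mul_transpose_apply (e f : PairIdx V) :
    (pairIncidence V * (pairIncidence V)ᵀ) e f
      = if e = f then 2 else if ∀ x, x ∈ e.1 → x ∉ f.1 then 0 else 1 := by
  have hmul : (pairIncidence V * (pairIncidence V)ᵀ) e f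
      = ∑ i, if i ∈ e.1 ∧ i ∈ f.1 then 1 else 0 := by
    simp only [pairIncidence, Matrix.mul_apply, transpose_apply, of_apply, ite_and]
    exact Finset.sum_congr rfl fun i _ => by split_ifs <;> simp
  rw [hmul]
  split_ifs with h1 h2
  · subst h1
    simpa using sum_mem_pair (R := ℂ) e
  · exact Finset.sum_eq_zero fun i _ => if_neg fun h => h2 i h.1 h.2
  · push Not at h2
    obtain ⟨i, hie, hif⟩ := h2
    obtain ⟨j, hj, rfl⟩ := exists_eq_pr_of_mem hie
    obtain ⟨k, hk, rfl⟩ := exists_eq_pr_of_mem hif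
    rw [Finset.sum_eq_single i]
    · simp [hie, hif]
    · rintro b - hb
      refine if_neg fun h => h1 ?_
      have h3 := (mem_pr.1 h.1).resolve_left hb
      have h4 := (mem_pr.1 h.2).resolve_left hb
      subst h3; subst h4; rfl
    · simp

lemma transpose_mul_pairIncidence_apply (i k : V) :
    ((pairIncidence V)ᵀ * pairIncidence V) i k
      = (if i = k then (Fintype.card V : ℂ) - 2 else 0) + 1 := by
  have hmul : ((pairIncidence V)ᵀ * pairIncidence V) i k
      = ∑ e : PairIdx V, if i ∈ e.1 then (if k ∈ e.1 then 1 else 0) else 0 := by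
    simp only [pairIncidence, Matrix.mul_apply, transpose_apply, of_apply]
    exact Finset.sum_congr rfl fun i _ => by split_ifs <;> simp
  rw [hmul, sum_mem_eq_sum_pr]
  simp only [mem_pr]
  split_ifs with h
  · subst h
    have hj (j : V) : (if h : i ≠ j then (if i = i ∨ i = j then (1 : ℂ) else 0) else 0)
        = 1 - if i = j then 1 else 0 := by
      by_cases h : i = j <;> simp [h]
    rw [Finset.sum_congr rfl fun j _ => hj j, Finset.sum_sub_distrib]
    simp
    ring
  · rw [Finset.sum_eq_single k]
    · simp [h]
    · intro j _ hj
      split_ifs with h1 h2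
      · rcases h2 with h2 | h2
        · exact absurd h2.symm h
        · exact absurd h2.symm hj
      · rfl
      · rfl
    · simp

lemma card_pairIdx {R : Type*} [Field R] [CharZero R] :
    (Fintype.card (PairIdx V) : R) = Fintype.card V * (Fintype.card V - 1) / 2 := by
  have h : Fintype.card (PairIdx V) = (Fintype.card V).choose 2 := Sym2.card_subtype_not_diag
  rw [h, Nat.cast_choose_two]

/-- Every vertex lies in `card V - 1` pairs. -/
lemma sum_pairIncidence (i : V) :
    ∑ e : PairIdx V, pairIncidence V e i = (Fintype.card V : ℂ) - 1 := by
  simp only [pairIncidence, of_apply]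
  rw [sum_mem_eq_sum_pr]
  have hj (j : V) : (if h : i ≠ j then (1 : ℂ) else 0) = 1 - if i = j then 1 else 0 := by
    by_cases h : i = j <;> simp [h]
  simp only [hj, Finset.sum_sub_distrib]
  simp

variable (V) in
/-- The Gram matrix `B Bᵀ` of the incidence matrix `B`. -/
def pairGram : Matrix (PairIdx V) (PairIdx V) ℂ := pairIncidence V * (pairIncidence V)ᵀ

lemma pairGram_mul_self :
    pairGram V * pairGram V
      = ((Fintype.card V : ℂ) - 2) • pairGram V + (4 : ℂ) • pairOnes V := by
  have h1 : (pairIncidence V)ᵀ * pairIncidence V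
      = ((Fintype.card V : ℂ) - 2) • (1 : Matrix V V ℂ) + Matrix.of fun _ _ => 1 := by
    ext i k
    rw [transpose_mul_pairIncidence_apply]
    simp [Matrix.one_apply]
  have h2 : pairIncidence V * (Matrix.of fun _ _ => 1 : Matrix V V ℂ) * (pairIncidence V)ᵀ
      = (4 : ℂ) • pairOnes V := by
    ext e f
    simp only [Matrix.mul_apply, of_apply, mul_one, transpose_apply, ← Finset.mul_sum]
    simp only [pairIncidence, of_apply, sum_mem_pair, pairOnes, Matrix.smul_apply, smul_eq_mul]
    norm_num
  calc pairGram V * pairGram V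
      = pairIncidence V * ((pairIncidence V)ᵀ * pairIncidence V) * (pairIncidence V)ᵀ := by
        simp only [pairGram, Matrix.mul_assoc]
    _ = _ := by
        rw [h1, Matrix.mul_add, Matrix.add_mul, h2]
        simp [pairGram]

lemma pairGram_transpose : (pairGram V)ᵀ = pairGram V := by
  simp [pairGram, Matrix.transpose_mul]

lemma pairGram_mul_pairOnes :
    pairGram V * pairOnes V = (2 * ((Fintype.card V : ℂ) - 1)) • pairOnes V := by
  have h : (pairIncidence V)ᵀ * pairOnes V = Matrix.of fun _ _ => (Fintype.card V : ℂ) - 1 := by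
    ext i e
    simp [Matrix.mul_apply, pairOnes, sum_pairIncidence]
  rw [pairGram, Matrix.mul_assoc, h]
  ext e f
  simp only [Matrix.mul_apply, pairOnes, pairIncidence, of_apply, ← Finset.sum_mul, sum_mem_pair,
    Matrix.smul_apply, smul_eq_mul, mul_one]

lemma pairOnes_mul_pairGram :
    pairOnes V * pairGram V = (2 * ((Fintype.card V : ℂ) - 1)) • pairOnes V := by
  simpa [Matrix.transpose_mul, pairOnes_transpose, pairGram_transpose] using
    congrArg Matrix.transpose (pairGram_mul_pairOnes (V := V))

lemma pairOnes_mul_self :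
    pairOnes V * pairOnes V
      = ((Fintype.card V : ℂ) * (Fintype.card V - 1) / 2) • pairOnes V := by
  ext e f
  simp [Matrix.mul_apply, pairOnes, card_pairIdx]

variable (V) in
/-- The projection onto the functions on pairs with vanishing sum around every vertex. -/
def pairProj : Matrix (PairIdx V) (PairIdx V) ℂ :=
  1 - (1 / ((Fintype.card V : ℂ) - 2)) • pairGram V
    + (2 / (((Fintype.card V : ℂ) - 1) * ((Fintype.card V : ℂ) - 2))) • pairOnes V

lemma pairProj_conjTranspose : (pairProj V)ᴴ = pairProj V := by
  have h1 : (pairGram V)ᴴ = pairGram V := by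
    ext e f
    rw [conjTranspose_apply, ← transpose_apply (pairGram V), pairGram_transpose]
    simp only [pairGram, pairIncidence_mul_transpose_apply]
    split_ifs <;> simp
  have h2 : (pairOnes V)ᴴ = pairOnes V := by ext; simp [pairOnes]
  simp [pairProj, conjTranspose_add, conjTranspose_sub, conjTranspose_smul, h1, h2]

lemma pairProj_mul_self (h1 : (Fintype.card V : ℂ) - 1 ≠ 0) (h2 : (Fintype.card V : ℂ) - 2 ≠ 0) :
    pairProj V * pairProj V = pairProj V := by
  simp only [pairProj, Matrix.add_mul, Matrix.sub_mul, Matrix.mul_add, Matrix.mul_sub,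
    Matrix.smul_mul, Matrix.mul_smul, pairGram_mul_self, pairGram_mul_pairOnes,
    pairOnes_mul_pairGram, pairOnes_mul_self, Matrix.one_mul, Matrix.mul_one]
  match_scalars <;> field_simp <;> ring

end Incidence

section UpperBound

variable {V : Type*} [Fintype V] [DecidableEq V] {M : Matrix (MIdx V) (MIdx V) ℂ}

/-- `Re M(I, h_{ij})`, extended by `0` to `i = j`. -/
def pairMoment (M : Matrix (MIdx V) (MIdx V) ℂ) (i j : V) : ℝ :=
  if h : i ≠ j then (M none (some (pr i j h))).re else 0

/-- `Re M(h_{ij}, h_{ik})`, extended by `0` to degenerate indices. -/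
def starMoment (M : Matrix (MIdx V) (MIdx V) ℂ) (i j k : V) : ℝ :=
  if hj : i ≠ j then if hk : i ≠ k then (M (some (pr i j hj)) (some (pr i k hk))).re else 0 else 0

lemma starMoment_add_swap (hM : IsMomentMatrix M) (i j k : V) :
    starMoment M i j k + starMoment M i k j
      = (pairMoment M i j + pairMoment M i k - pairMoment M j k) / 2
        + if j = k then pairMoment M i j else 0 := by
  obtain ⟨-, -, hdiag, -, htri⟩ := hM
  by_cases hij : i = j
  · subst hij
    by_cases hik : i = k <;> simp [starMoment, pairMoment, hik]
  by_cases hik : i = k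
  · subst hik
    simp [starMoment, pairMoment, hij, Ne.symm hij, pr_comm i j]
  by_cases hjk : j = k
  · subst hjk
    simp [starMoment, pairMoment, hij, hdiag]
  have h := congrArg Complex.re (htri j i k (Ne.symm hij) hik hjk)
  rw [pr_comm j i] at h
  simp only [starMoment, pairMoment, ne_eq, hij, hik, hjk, not_false_eq_true, dite_true, if_false]
  simpa using h

lemma sum_pairMoment :
    ∑ i, ∑ j, pairMoment M i j = 2 * ∑ e : PairIdx V, (M none (some e)).re := by
  have h (i : V) := sum_mem_eq_sum_pr i fun e => (M none (some e)).re
  simp only [pairMoment, ← h]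
  rw [Finset.sum_comm, Finset.mul_sum]
  refine Finset.sum_congr rfl fun e _ => ?_
  rw [← sum_mem_pair (R := ℝ) e, Finset.sum_mul]
  simp

lemma sum_starMoment (hM : IsMomentMatrix M) :
    ∑ i, ∑ j, ∑ k, starMoment M i j k
      = ((Fintype.card V : ℝ) + 2) / 2 * ∑ e : PairIdx V, (M none (some e)).re := by
  have hswap : ∑ i, ∑ j, ∑ k, starMoment M i k j = ∑ i, ∑ j, ∑ k, starMoment M i j k :=
    Finset.sum_congr rfl fun i _ => Finset.sum_comm
  have h : ∑ i, ∑ j, ∑ k, (starMoment M i j k + starMoment M i k j)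
      = ∑ i, ∑ j, ∑ k, ((pairMoment M i j + pairMoment M i k - pairMoment M j k) / 2
        + if j = k then pairMoment M i j else 0) := by
    simp only [starMoment_add_swap hM]
  simp only [Finset.sum_add_distrib, hswap, ← Finset.sum_div, Finset.sum_sub_distrib,
    Finset.sum_const, Finset.sum_ite_eq, Finset.mem_univ, if_true,
    Finset.card_univ, nsmul_eq_mul, ← Finset.mul_sum, sum_pairMoment] at h
  linarith

/-- The quadratic form of `M` at the level-1 certificate vector `α I - ∑_{e ∋ i} h_e`. -/
lemma star_form_nonneg (hM : IsMomentMatrix M) (α : ℝ) (i : V) :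
    0 ≤ α ^ 2 - 2 * α * ∑ j, pairMoment M i j + ∑ j, ∑ k, starMoment M i j k := by
  set x : MIdx V → ℂ := fun o => o.elim (α : ℂ) fun e => -(if i ∈ e.1 then 1 else 0)
  have hpos := hM.1.re_dotProduct_nonneg x
  have hre (e : PairIdx V) : (M (some e) none).re = (M none (some e)).re := by
    rw [← hM.1.1.apply none (some e)]; simp
  have hp : ∑ j, pairMoment M i j
      = ∑ e : PairIdx V, if i ∈ e.1 then (M none (some e)).re else 0 :=
    (sum_mem_eq_sum_pr i fun e => (M none (some e)).re).symm
  have hs : ∑ j, ∑ k, starMoment M i j k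
      = ∑ e : PairIdx V, if i ∈ e.1 then
          ∑ f : PairIdx V, (if i ∈ f.1 then (M (some e) (some f)).re else 0) else 0 := by
    rw [sum_mem_eq_sum_pr]
    refine Finset.sum_congr rfl fun j _ => ?_
    by_cases h : i = j
    · simp [starMoment, h]
    · simp [starMoment, h, sum_mem_eq_sum_pr]
  convert hpos using 1
  rw [hp, hs]
  simp only [dotProduct, mulVec, Fintype.sum_option, Pi.star_apply, x, Option.elim_none,
    Option.elim_some, hM.2.1]
  simp [Finset.mul_sum, hre, apply_ite Complex.re, Finset.sum_add_distrib, mul_add]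
  have hlin : ∑ e : PairIdx V, (if i ∈ e.1 then 2 * α * (M none (some e)).re else 0)
      = ∑ e : PairIdx V, (if i ∈ e.1 then α * (M none (some e)).re else 0)
        + ∑ e : PairIdx V, if i ∈ e.1 then (M none (some e)).re * α else 0 := by
    rw [← Finset.sum_add_distrib]
    exact Finset.sum_congr rfl fun e _ => by split_ifs <;> ring
  have hquad : ∑ e : PairIdx V, (if i ∈ e.1 then
        ∑ f : PairIdx V, (if i ∈ f.1 then (M (some e) (some f)).re else 0) else 0)
      = -∑ e : PairIdx V, ∑ f : PairIdx V,
          if i ∈ f.1 then -(if i ∈ e.1 then (M (some e) (some f)).re else 0) else 0 := by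
    simp only [← Finset.sum_neg_distrib]
    refine Finset.sum_congr rfl fun e _ => ?_
    by_cases h : i ∈ e.1 <;> simp [h, neg_ite]
  rw [hlin, hquad]
  ring

lemma sum_le_of_isMomentMatrix (hM : IsMomentMatrix M) :
    ∑ e : PairIdx V, (M none (some e)).re
      ≤ (Fintype.card V : ℝ) * ((Fintype.card V : ℝ) + 2) / 8 := by
  set n : ℝ := (Fintype.card V : ℝ) with hn
  have h : 0 ≤ ∑ i, (((n + 2) / 4) ^ 2 - 2 * ((n + 2) / 4) * ∑ j, pairMoment M i j
      + ∑ j, ∑ k, starMoment M i j k) :=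
    Finset.sum_nonneg fun i _ => star_form_nonneg hM _ i
  simp only [Finset.sum_add_distrib, Finset.sum_sub_distrib, ← Finset.mul_sum, sum_pairMoment,
    sum_starMoment hM, Finset.sum_const, Finset.card_univ, nsmul_eq_mul, ← hn] at h
  have hn0 : 0 ≤ n := Nat.cast_nonneg _
  nlinarith

end UpperBound

section Feasibility

/-- The projection `pairProj` with a zero column added for the symbol `I`. -/
def pairProjExt (V : Type*) [Fintype V] [DecidableEq V] : Matrix (PairIdx V) (MIdx V) ℂ :=
  Matrix.of fun e o => o.elim 0 (pairProj V e)

lemma completeMM_eq (n : ℕ) (hn : 4 ≤ n) :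
    completeMM n
      = vecMulVec (fun o : MIdx (Fin n) => o.elim (1 : ℂ) fun _ => ((n : ℂ) + 2) / (4 * (n - 1)))
          (star fun o : MIdx (Fin n) => o.elim (1 : ℂ) fun _ => ((n : ℂ) + 2) / (4 * (n - 1)))
        + (((n + 2) * (3 * n - 6) / (16 * (n - 1) * (n - 3)) : ℝ) : ℂ) •
          ((pairProjExt (Fin n))ᴴ * pairProjExt (Fin n)) := by
  have ne (k : ℕ) (hk : k < 4) : (n : ℂ) - k ≠ 0 := by
    rw [sub_ne_zero]; exact_mod_cast (by omega : n ≠ k)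
  have h1 : (n : ℂ) - 1 ≠ 0 := by simpa using ne 1 (by norm_num)
  have h2 : (n : ℂ) - 2 ≠ 0 := by simpa using ne 2 (by norm_num)
  have h3 : (n : ℂ) - 3 ≠ 0 := by simpa using ne 3 (by norm_num)
  have hP : pairProj (Fin n) * pairProj (Fin n) = pairProj (Fin n) :=
    pairProj_mul_self (by simpa using h1) (by simpa using h2)
  ext r c
  rcases r with _ | e <;> rcases c with _ | f
  · simp [completeMM, Matrix.mul_apply, pairProjExt, vecMulVec_apply]
  · simp [completeMM, Matrix.mul_apply, pairProjExt, vecMulVec_apply]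
  · simp [completeMM, Matrix.mul_apply, pairProjExt, vecMulVec_apply]
  · have hPP : ∑ g, star (pairProj (Fin n) g e) * pairProj (Fin n) g f = pairProj (Fin n) e f := by
      rw [← congrFun₂ hP e f, Matrix.mul_apply]
      refine Finset.sum_congr rfl fun g _ => ?_
      rw [← conjTranspose_apply, pairProj_conjTranspose]
    simp only [completeMM, pairProjExt, of_apply, Matrix.add_apply, vecMulVec_apply, Pi.star_apply, Option.elim_some,
      Matrix.smul_apply, Matrix.mul_apply, conjTranspose_apply, hPP]
    simp only [pairProj, Matrix.add_apply, Matrix.sub_apply, Matrix.smul_apply, pairGram,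
      pairIncidence_mul_transpose_apply, pairOnes, of_apply, Matrix.one_apply, Fintype.card_fin]
    split_ifs <;> simp <;> field_simp <;> ring

lemma completeMM_posSemidef (n : ℕ) (hn : 4 ≤ n) : (completeMM n).PosSemidef := by
  have hn' : (4 : ℝ) ≤ n := by exact_mod_cast hn
  rw [completeMM_eq n hn]
  refine (posSemidef_vecMulVec_self_star _).add ((posSemidef_conjTranspose_mul_self _).smul ?_)
  rw [Complex.zero_le_real]
  exact div_nonneg (mul_nonneg (by linarith) (by linarith))
    (mul_nonneg (by linarith) (by linarith))

lemma completeMM_isMomentMatrix (n : ℕ) (hn : 4 ≤ n) : IsMomentMatrix (completeMM n) := by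
  refine ⟨completeMM_posSemidef n hn, rfl, fun e => by simp [completeMM], fun e f hef => ?_,
    fun i j k hij hjk hik => ?_⟩
  · have h : ∀ x : Fin n, x ∈ f.1 → x ∉ e.1 := fun x hf he => hef x he hf
    by_cases hf : e = f
    · rw [hf]
    · simp only [completeMM, of_apply, if_neg hf, if_neg (Ne.symm hf), if_pos hef, if_pos h]
  · have hne : pr i j hij ≠ pr j k hjk := by
      rw [pr_comm i j]
      exact fun h => hik (pr_right_injective h)
    have h1 : ¬ ∀ x : Fin n, x ∈ (pr i j hij).1 → x ∉ (pr j k hjk).1 :=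
      fun h => h j (mem_pr.2 (Or.inr rfl)) (mem_pr.2 (Or.inl rfl))
    have h2 : ¬ ∀ x : Fin n, x ∈ (pr j k hjk).1 → x ∉ (pr i j hij).1 :=
      fun h => h j (mem_pr.2 (Or.inl rfl)) (mem_pr.2 (Or.inr rfl))
    have hn1 : (n : ℂ) - 1 ≠ 0 := by
      rw [sub_ne_zero]; exact_mod_cast (by omega : n ≠ 1)
    simp only [completeMM, of_apply, if_neg hne, if_neg (Ne.symm hne), if_neg h1, if_neg h2]
    push_cast
    field_simp
    ring

lemma sum_completeMM (n : ℕ) (hn : 4 ≤ n) :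
    ∑ e : PairIdx (Fin n), ((completeMM n) none (some e)).re = (n : ℝ) * ((n : ℝ) + 2) / 8 := by
  have hn1 : (n : ℝ) - 1 ≠ 0 := by
    rw [sub_ne_zero]; exact_mod_cast (by omega : n ≠ 1)
  simp only [completeMM, of_apply, Complex.ofReal_re, Finset.sum_const, Finset.card_univ,
    nsmul_eq_mul, card_pairIdx, Fintype.card_fin]
  field_simp
  ring

end Feasibility

/-- The explicit matrix `completeMM n` is a feasible `NPA₁(Proj)` moment matrix with
objective `n(n+2)/8` on the uniform complete graph; consequently the optimal value of
`NPA₁(Proj)` on the complete graph with `n` vertices is exactly `n(n+2)/8`. -/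
theorem stmt14 (n : ℕ) (hn : 4 ≤ n) :
    (completeMM n).PosSemidef ∧
    IsMomentMatrix (completeMM n) ∧
    ∑ e : PairIdx (Fin n), ((completeMM n) none (some e)).re
      = (n : ℝ) * ((n : ℝ) + 2) / 8 ∧
    sSup {v : ℝ | ∃ M : Matrix (MIdx (Fin n)) (MIdx (Fin n)) ℂ, IsMomentMatrix M ∧
        v = ∑ e : PairIdx (Fin n), (M none (some e)).re}
      = (n : ℝ) * ((n : ℝ) + 2) / 8 := by
  refine ⟨completeMM_posSemidef n hn, completeMM_isMomentMatrix n hn, sum_completeMM n hn, ?_⟩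
  refine IsGreatest.csSup_eq ⟨⟨completeMM n, completeMM_isMomentMatrix n hn,
    (sum_completeMM n hn).symm⟩, ?_⟩
  rintro _ ⟨M, hM, rfl⟩
  simpa using sum_le_of_isMomentMatrix hM

end
end
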